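/- arXiv:2008.09251 — 3 statements merged into one kernel-verified Lean document; each statement's English description precedes it below -/
import Mathlib

section
/- Under the FPL algorithm with any parameter η > 0, the one-step-lookahead policies satisfy E[Σ_{t=1}^T V^{π_{t+1}}(r_t)] ≥ OPT − (H + H·ln(SA))/η. -/
open MeasureTheory ProbabilityTheory

section MDP

variable {S A : Type} [Fintype S] [Fintype A]

/-- Validity of a transition kernel given as a function `S → A → S → ℝ`. -/
def IsKernel (p : S → A → S → ℝ) : Prop :=
  (∀ s a s', 0 ≤ p s a s') ∧ ∀ s a, ∑ s' : S, p s a s' = 1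

/-- `polVal p r π n h s` is the expected reward collected by the deterministic policy `π`
in the MDP with transition kernel `p` and reward `r`, over `n` steps starting at
state `s` in layer `h` (the layer increases by one at each step).  The value
`V^π_h(s, r)` of the paper is `polVal p r π (H + 1 - h) h s`, and
`V^π(r) = polVal p r π H 1 s₁`. -/
noncomputable def polVal (p : S → A → S → ℝ) (r : S → A → ℕ → ℝ) (π : S → ℕ → A) :
    ℕ → ℕ → S → ℝ
  | 0, _, _ => 0
  | n + 1, h, s =>
      r s (π s h) h + ∑ s' : S, p s (π s h) s' * polVal p r π n (h + 1) s'

/-- `optVal p r n h s` is the optimal value over `n` steps starting at state `s`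
in layer `h`, computed by backward value iteration. -/
noncomputable def optVal [Nonempty A] (p : S → A → S → ℝ) (r : S → A → ℕ → ℝ) :
    ℕ → ℕ → S → ℝ
  | 0, _, _ => 0
  | n + 1, h, s =>
      ⨆ a : A, (r s a h + ∑ s' : S, p s a s' * optVal p r n (h + 1) s')

/-- A policy is optimal for the reward `r` in the horizon-`H` MDP if it attains the optimal
value at every state and layer; this is exactly what backward value iteration produces. -/
def IsOptimal [Nonempty A] (p : S → A → S → ℝ) (r : S → A → ℕ → ℝ) (H : ℕ)
    (π : S → ℕ → A) : Prop :=
  ∀ h s, 1 ≤ h → h ≤ H → polVal p r π (H + 1 - h) h s = optVal p r (H + 1 - h) h s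

end MDP

section Helpers

open Filter Topology

variable {S A : Type} [Fintype S] [Fintype A]

lemma polVal_add (p : S → A → S → ℝ) (r r' : S → A → ℕ → ℝ) (π : S → ℕ → A) (n : ℕ) :
    ∀ h s, polVal p (fun s a h => r s a h + r' s a h) π n h s
      = polVal p r π n h s + polVal p r' π n h s := by
  induction n with
  | zero => intro h s; simp [polVal]
  | succ n ih =>
    intro h s
    simp only [polVal, ih, mul_add, Finset.sum_add_distrib]
    ring

lemma polVal_le_optVal [Nonempty A] (p : S → A → S → ℝ) (hp : IsKernel p)
    (r : S → A → ℕ → ℝ) (π : S → ℕ → A) (n : ℕ) :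
    ∀ h s, polVal p r π n h s ≤ optVal p r n h s := by
  induction n with
  | zero => intro h s; simp [polVal, optVal]
  | succ n ih =>
    intro h s
    simp only [polVal, optVal]
    refine le_trans ?_ (le_ciSup (f := fun a => r s a h + ∑ s' : S, p s a s' * optVal p r n (h + 1) s')
      (Set.finite_range _).bddAbove (π s h))
    gcongr with s' _
    · exact hp.1 _ _ _
    · exact ih _ _

lemma polVal_le_sum (p : S → A → S → ℝ) (hp : IsKernel p)
    (r : S → A → ℕ → ℝ) (M : ℕ → ℝ) (hM : ∀ s a h, r s a h ≤ M h) (π : S → ℕ → A) (n : ℕ) :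
    ∀ h s, polVal p r π n h s ≤ ∑ i ∈ Finset.range n, M (h + i) := by
  induction n with
  | zero => intro h s; simp [polVal]
  | succ n ih =>
    intro h s
    simp only [polVal]
    rw [Finset.sum_range_succ', add_comm (Finset.sum _ _)]
    refine add_le_add (hM _ _ _) ?_
    calc _ ≤ ∑ s' : S, p s (π s h) s' * ∑ i ∈ Finset.range n, M (h + (i + 1)) := by
          gcongr with s' _
          · exact hp.1 _ _ _
          · refine (ih _ _).trans (le_of_eq ?_)
            refine Finset.sum_congr rfl fun i _ => ?_
            congr 1; ring
      _ = _ := by rw [← Finset.sum_mul, hp.2, one_mul]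

lemma polVal_nonneg (p : S → A → S → ℝ) (hp : IsKernel p)
    (r : S → A → ℕ → ℝ) (H : ℕ) (hM : ∀ s a h, 1 ≤ h → h ≤ H → 0 ≤ r s a h)
    (π : S → ℕ → A) (n : ℕ) :
    ∀ h s, 1 ≤ h → h + n ≤ H + 1 → 0 ≤ polVal p r π n h s := by
  induction n with
  | zero => intro h s _ _; simp [polVal]
  | succ n ih =>
    intro h s h1 h2
    simp only [polVal]
    refine add_nonneg (hM _ _ _ h1 (by omega)) (Finset.sum_nonneg fun s' _ => ?_)
    exact mul_nonneg (hp.1 _ _ _) (ih _ _ (by omega) (by omega))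

lemma exp_tail (η : ℝ) (hη : 0 < η) (c : ℝ) (hc : 0 ≤ c) :
    Integrable (fun x : ℝ => max (x - c) 0) (expMeasure η) ∧
      ∫ x, max (x - c) 0 ∂(expMeasure η) = Real.exp (-(η * c)) / η := by
  have hder : ∀ x ∈ Set.Ici c, HasDerivAt (fun x => -((x - c + 1 / η) * Real.exp (-(η * x))))
      ((x - c) * (η * Real.exp (-(η * x)))) x := by
    intro x _
    have h1 : HasDerivAt (fun x : ℝ => x - c + 1 / η) 1 x :=
      ((hasDerivAt_id x).sub_const c).add_const (1 / η)
    have h2 : HasDerivAt (fun x : ℝ => Real.exp (-(η * x))) (Real.exp (-(η * x)) * (-(η * 1))) x :=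
      (((hasDerivAt_id x).const_mul η).neg).exp
    refine ((h1.mul h2).neg).congr_deriv ?_
    field_simp
    ring
  have hpos : ∀ x ∈ Set.Ioi c, 0 ≤ (x - c) * (η * Real.exp (-(η * x))) := by
    intro x hx
    have : 0 ≤ x - c := sub_nonneg.2 (le_of_lt hx)
    positivity
  have hlim : Tendsto (fun x => -((x - c + 1 / η) * Real.exp (-(η * x)))) atTop (𝓝 0) := by
    have hid : Tendsto (fun x : ℝ => η * x) atTop atTop := tendsto_id.const_mul_atTop hη
    have h1 := (Real.tendsto_pow_mul_exp_neg_atTop_nhds_zero 1).comp hid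
    have h0 := (Real.tendsto_pow_mul_exp_neg_atTop_nhds_zero 0).comp hid
    have h3 := ((h1.const_mul (1 / η)).add (h0.const_mul (1 / η - c))).neg
    simp only [mul_zero, add_zero, neg_zero] at h3
    refine h3.congr fun x => ?_
    simp only [Function.comp]
    field_simp
    ring
  have hI := integrableOn_Ioi_deriv_of_nonneg' hder hpos hlim
  have hE := integral_Ioi_of_hasDerivAt_of_nonneg' hder hpos hlim
  have hfun : (fun x : ℝ => (gammaPDF 1 η x).toReal • max (x - c) 0)
      = (Set.Ioi c).indicator (fun x => (x - c) * (η * Real.exp (-(η * x)))) := by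
    funext x
    have hg : (gammaPDF 1 η x).toReal = if 0 ≤ x then η * Real.exp (-(η * x)) else 0 := by
      have := exponentialPDF_eq η x
      rw [show gammaPDF 1 η x = exponentialPDF η x from rfl, this, ENNReal.toReal_ofReal]
      split_ifs
      · positivity
      · exact le_rfl
    rw [hg]
    by_cases hx : c < x
    · rw [Set.indicator_of_mem (show x ∈ Set.Ioi c from hx), if_pos (by linarith),
        max_eq_left (by linarith), smul_eq_mul, mul_comm]
    · rw [Set.indicator_of_notMem (show x ∉ Set.Ioi c from hx), max_eq_right (by linarith), smul_zero]
  have hm : Measurable (gammaPDF 1 η) := (measurable_gammaPDFReal 1 η).ennreal_ofReal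
  have hfin : ∀ᵐ x : ℝ, gammaPDF 1 η x < ⊤ := ae_of_all _ fun x => ENNReal.ofReal_lt_top
  constructor
  · rw [expMeasure, gammaMeasure, integrable_withDensity_iff_integrable_smul' hm hfin, hfun]
    exact (integrable_indicator_iff measurableSet_Ioi).2 hI
  · rw [expMeasure, gammaMeasure, integral_withDensity_eq_integral_toReal_smul hm hfin, hfun,
      integral_indicator measurableSet_Ioi, hE]
    field_simp
    ring

lemma exp_nonneg_ae (η : ℝ) : ∀ᵐ x ∂(expMeasure η), 0 ≤ x := by
  rw [ae_iff]
  have : {a : ℝ | ¬ 0 ≤ a} = Set.Iio 0 := by ext; simp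
  rw [this, expMeasure, gammaMeasure, withDensity_apply _ measurableSet_Iio]
  exact lintegral_gammaPDF_of_nonpos le_rfl

end Helpers


/-- Under the FPL algorithm with any parameter `η > 0`, the
one-step-lookahead policies satisfy
`E[Σ_{t=1}^T V^{π_{t+1}}(r_t)] ≥ OPT − (H + H ln(SA))/η`. -/
theorem fpl_be_the_leader
    {S A : Type} [Fintype S] [Fintype A] [Nonempty S] [Nonempty A]
    {Ω : Type} [MeasurableSpace Ω] (P : Measure Ω) [IsProbabilityMeasure P]
    (H T : ℕ) (hH : 0 < H) (hT : 0 < T) (s₁ : S)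
    (p : S → A → S → ℝ) (hp : IsKernel p)
    (η : ℝ) (hη : 0 < η)
    (r : ℕ → S → A → ℕ → ℝ) (hr : ∀ t s a h, 0 ≤ r t s a h ∧ r t s a h ≤ 1)
    (R0 : Ω → S → A → ℕ → ℝ)
    (hR0dist : ∀ s a h, 1 ≤ h → h ≤ H →
      Measure.map (fun ω => R0 ω s a h) P = expMeasure η)
    (hR0indep : iIndepFun
      (fun (x : S × A × Fin H) ω => R0 ω x.1 x.2.1 (x.2.2.val + 1)) P)
    (π : ℕ → Ω → S → ℕ → A)
    (hπopt : ∀ t ω, IsOptimal p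
      (fun s a h => R0 ω s a h + ∑ τ ∈ Finset.Icc 1 (t - 1), r τ s a h) H (π t ω))
    (hπmeas : ∀ t, Measurable fun ω => polVal p (r t) (π (t + 1) ω) H 1 s₁) :
    ∀ πstar : S → ℕ → A,
      ∫ ω, ∑ t ∈ Finset.Icc 1 T, polVal p (r t) (π (t + 1) ω) H 1 s₁ ∂P
        ≥ polVal p (fun s a h => ∑ τ ∈ Finset.Icc 1 T, r τ s a h) πstar H 1 s₁
            - (H + H * Real.log (Fintype.card S * Fintype.card A)) / η := by
  intro πstar
  have : IsProbabilityMeasure (expMeasure η) := isProbabilityMeasure_expMeasure hη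
  -- the threshold
  set N : ℝ := (Fintype.card S * Fintype.card A : ℝ) with hN
  have hN1 : 1 ≤ N := by
    have h1 : (1 : ℝ) ≤ Fintype.card S := by exact_mod_cast Fintype.card_pos
    have h2 : (1 : ℝ) ≤ Fintype.card A := by exact_mod_cast Fintype.card_pos
    nlinarith
  set c : ℝ := Real.log N / η with hc
  have hc0 : 0 ≤ c := div_nonneg (Real.log_nonneg hN1) hη.le
  obtain ⟨hint, hval⟩ := exp_tail η hη c hc0
  have hval' : Real.exp (-(η * c)) / η = 1 / (N * η) := by
    rw [hc, mul_div_cancel₀ _ hη.ne', Real.exp_neg, Real.exp_log (by linarith)]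
    field_simp
  have haem : ∀ s a h, 1 ≤ h → h ≤ H → AEMeasurable (fun ω => R0 ω s a h) P := by
    intro s a h h1 h2
    apply AEMeasurable.of_map_ne_zero
    rw [hR0dist s a h h1 h2]
    exact IsProbabilityMeasure.ne_zero _
  have hInt : ∀ s a h, 1 ≤ h → h ≤ H → Integrable (fun ω => max (R0 ω s a h - c) 0) P := by
    intro s a h h1 h2
    have hh := hint
    rw [← hR0dist s a h h1 h2] at hh
    exact hh.comp_aemeasurable (haem s a h h1 h2)
  have hE : ∀ s a h, 1 ≤ h → h ≤ H → ∫ ω, max (R0 ω s a h - c) 0 ∂P = 1 / (N * η) := by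
    intro s a h h1 h2
    rw [← hval', ← hval, ← hR0dist s a h h1 h2, integral_map (haem s a h h1 h2)]
    exact (by fun_prop : Measurable fun x : ℝ => max (x - c) 0).aestronglyMeasurable
  have hnn : ∀ᵐ ω ∂P, ∀ s a, ∀ h ∈ Finset.Icc 1 H, 0 ≤ R0 ω s a h := by
    rw [ae_all_iff]; intro s
    rw [ae_all_iff]; intro a
    rw [Finset.eventually_all]; intro h hh
    rw [Finset.mem_Icc] at hh
    have h0 := exp_nonneg_ae η
    rw [← hR0dist s a h hh.1 hh.2] at h0
    exact ae_of_ae_map (haem s a h hh.1 hh.2) h0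
  -- the bound
  let M : Ω → ℕ → ℝ := fun ω h => c + ∑ s : S, ∑ a : A, max (R0 ω s a h - c) 0
  have hM : ∀ ω s a h, R0 ω s a h ≤ M ω h := by
    intro ω s a h
    have h1 : max (R0 ω s a h - c) 0 ≤ ∑ a : A, max (R0 ω s a h - c) 0 :=
      Finset.single_le_sum (f := fun a => max (R0 ω s a h - c) 0)
        (fun _ _ => le_max_right _ _) (Finset.mem_univ a)
    have h2 : ∑ a : A, max (R0 ω s a h - c) 0 ≤ ∑ s : S, ∑ a : A, max (R0 ω s a h - c) 0 :=
      Finset.single_le_sum (f := fun s => ∑ a : A, max (R0 ω s a h - c) 0)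
        (fun _ _ => Finset.sum_nonneg fun _ _ => le_max_right _ _) (Finset.mem_univ s)
    have h3 := le_max_left (R0 ω s a h - c) 0
    simp only [M]
    linarith
  have hMint : ∀ h, 1 ≤ h → h ≤ H → Integrable (fun ω => M ω h) P := by
    intro h h1 h2
    refine (integrable_const c).add (integrable_finsetSum _ fun s _ => integrable_finsetSum _ fun a _ => ?_)
    exact hInt s a h h1 h2
  have hME : ∀ h, 1 ≤ h → h ≤ H → ∫ ω, M ω h ∂P = c + 1 / η := by
    intro h h1 h2
    simp only [M]
    rw [integral_add (integrable_const c) (integrable_finsetSum _ fun s _ =>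
      integrable_finsetSum _ fun a _ => hInt s a h h1 h2),
      integral_finsetSum _ (fun s _ => integrable_finsetSum _ fun a _ => hInt s a h h1 h2)]
    have : ∀ s, ∫ ω, ∑ a : A, max (R0 ω s a h - c) 0 ∂P = ∑ a : A, 1 / (N * η) := by
      intro s
      rw [integral_finsetSum _ (fun a _ => hInt s a h h1 h2)]
      exact Finset.sum_congr rfl fun a _ => hE s a h h1 h2
    simp only [this]
    have hN0 : N ≠ 0 := by positivity
    simp only [integral_const, probReal_univ, one_smul, Finset.sum_const, Finset.card_univ,
      nsmul_eq_mul]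
    rw [← mul_assoc, ← hN]
    field_simp
  -- be the leader
  have hopt : ∀ t ω (π' : S → ℕ → A),
      polVal p (fun s a h => R0 ω s a h + ∑ τ ∈ Finset.Icc 1 t, r τ s a h) π' H 1 s₁
      ≤ polVal p (fun s a h => R0 ω s a h + ∑ τ ∈ Finset.Icc 1 t, r τ s a h) (π (t + 1) ω) H 1 s₁ := by
    intro t ω π'
    have h1 := hπopt (t + 1) ω 1 s₁ le_rfl hH
    simp only [Nat.add_sub_cancel] at h1
    rw [h1]
    exact polVal_le_optVal p hp _ _ _ _ _
  have hbtl : ∀ ω t,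
      polVal p (fun s a h => R0 ω s a h + ∑ τ ∈ Finset.Icc 1 t, r τ s a h) (π (t + 1) ω) H 1 s₁
      ≤ ∑ τ ∈ Finset.Icc 1 t, polVal p (r τ) (π (τ + 1) ω) H 1 s₁
        + polVal p (R0 ω) (π 1 ω) H 1 s₁ := by
    intro ω t
    induction t with
    | zero => simp
    | succ t ih =>
      have e : (fun s a h => R0 ω s a h + ∑ τ ∈ Finset.Icc 1 (t + 1), r τ s a h)
          = (fun s a h => (R0 ω s a h + ∑ τ ∈ Finset.Icc 1 t, r τ s a h) + r (t + 1) s a h) := by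
        funext s a h
        rw [Finset.sum_Icc_succ_top (by omega), add_assoc]
      rw [e, Finset.sum_Icc_succ_top (by omega),
        polVal_add p (fun s a h => R0 ω s a h + ∑ τ ∈ Finset.Icc 1 t, r τ s a h) (r (t + 1))]
      have := hopt t ω (π (t + 1 + 1) ω)
      linarith
  set OPT := polVal p (fun s a h => ∑ τ ∈ Finset.Icc 1 T, r τ s a h) πstar H 1 s₁ with hOPT
  have hpt : ∀ᵐ ω ∂P, OPT - ∑ i ∈ Finset.range H, M ω (1 + i)
      ≤ ∑ t ∈ Finset.Icc 1 T, polVal p (r t) (π (t + 1) ω) H 1 s₁ := by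
    filter_upwards [hnn] with ω hω
    have h1 := hbtl ω T
    have h2 := hopt T ω πstar
    rw [polVal_add p (R0 ω) (fun s a h => ∑ τ ∈ Finset.Icc 1 T, r τ s a h) πstar] at h2
    have h3 := polVal_nonneg p hp (R0 ω) H
      (fun s a h h1 h2 => hω s a h (Finset.mem_Icc.2 ⟨h1, h2⟩)) πstar H 1 s₁ le_rfl (by omega)
    have h4 := polVal_le_sum p hp (R0 ω) (M ω) (hM ω) (π 1 ω) H 1 s₁
    linarith
  have hVint : ∀ t, Integrable (fun ω => polVal p (r t) (π (t + 1) ω) H 1 s₁) P := by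
    intro t
    refine Integrable.of_bound (hπmeas t).aestronglyMeasurable H (ae_of_all _ fun ω => ?_)
    have h1 := polVal_nonneg p hp (r t) H (fun s a h _ _ => (hr t s a h).1) (π (t + 1) ω) H 1 s₁
      le_rfl (by omega)
    have h2 := polVal_le_sum p hp (r t) (fun _ => 1) (fun s a h => (hr t s a h).2)
      (π (t + 1) ω) H 1 s₁
    simp at h2
    rw [Real.norm_of_nonneg h1]
    exact h2
  have hsM : Integrable (fun ω => ∑ i ∈ Finset.range H, M ω (1 + i)) P :=
    integrable_finsetSum _ fun i hi => hMint _ (by omega) (by rw [Finset.mem_range] at hi; omega)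
  have hfin := integral_mono_ae ((integrable_const OPT).sub hsM)
    (integrable_finsetSum _ fun t _ => hVint t) hpt
  refine ge_iff_le.2 (le_trans (le_of_eq ?_) hfin)
  have hsum : ∫ ω, ∑ i ∈ Finset.range H, M ω (1 + i) ∂P = H * (c + 1 / η) := by
    rw [integral_finsetSum _ fun i hi => hMint _ (by omega) (by rw [Finset.mem_range] at hi; omega)]
    rw [Finset.sum_congr rfl fun i hi => hME (1 + i) (by omega)
      (by rw [Finset.mem_range] at hi; omega)]
    rw [Finset.sum_const, Finset.card_range, nsmul_eq_mul]
  simp only [Pi.sub_apply]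
  rw [integral_sub (integrable_const OPT) hsM, hsum]
  simp only [integral_const, probReal_univ, one_smul]
  rw [hc]
  ring
end

section
/- Under the FPL algorithm with parameter η > 0, for every episode t, state s, layer h, and action a, the probabilities (over the random perturbation r_0) of the chosen action satisfy e^{−η(H−h+1)} ≤ Pr[π_t(s,h) = a] / Pr[π_{t+1}(s,h) = a] ≤ e^{η(H−h+1)}. -/
open MeasureTheory ProbabilityTheory

theorem optVal_congr' {S A : Type} [Fintype S] [Fintype A] [Nonempty A]
    (p : S → A → S → ℝ) (r r' : S → A → ℕ → ℝ) (n h : ℕ)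
    (hrr : ∀ s a k, h ≤ k → k < h + n → r s a k = r' s a k) (s : S) :
    optVal p r n h s = optVal p r' n h s := by
  induction n generalizing h s with
  | zero => rfl
  | succ n ih =>
    simp only [optVal]
    congr 1
    funext a
    rw [hrr s a h le_rfl (by omega)]
    congr 1
    refine Finset.sum_congr rfl fun s' _ => ?_
    rw [ih (h + 1) (fun s a k h1 h2 => hrr s a k (by omega) (by omega))]

theorem optVal_le_add {S A : Type} [Fintype S] [Fintype A] [Nonempty A]
    (p : S → A → S → ℝ) (hp : IsKernel p) (r r' : S → A → ℕ → ℝ) (c : ℝ)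
    (hrr : ∀ s a k, r s a k ≤ r' s a k + c) (n h : ℕ) (s : S) :
    optVal p r n h s ≤ optVal p r' n h s + n * c := by
  induction n generalizing h s with
  | zero => simp [optVal]
  | succ n ih =>
    simp only [optVal]
    refine ciSup_le fun a => ?_
    have h1 : ∑ s' : S, p s a s' * optVal p r n (h + 1) s' ≤
        ∑ s' : S, p s a s' * optVal p r' n (h + 1) s' + n * c := by
      calc _ ≤ ∑ s' : S, p s a s' * (optVal p r' n (h + 1) s' + n * c) :=
            Finset.sum_le_sum fun s' _ => mul_le_mul_of_nonneg_left (ih _ _) (hp.1 _ _ _)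
        _ = _ := by
            simp only [mul_add, Finset.sum_add_distrib, ← Finset.sum_mul, hp.2, one_mul]
    have h2 := le_ciSup (f := fun a : A => r' s a h +
      ∑ s' : S, p s a s' * optVal p r' n (h + 1) s') (Set.finite_range _).bddAbove a
    have h3 := hrr s a h
    push_cast
    linarith

theorem IsOptimal.le_of {S A : Type} [Fintype S] [Fintype A] [Nonempty A]
    (p : S → A → S → ℝ) (r : S → A → ℕ → ℝ) (H : ℕ) (π : S → ℕ → A)
    (hπ : IsOptimal p r H π) (s : S) (h : ℕ) (h1 : 1 ≤ h) (h2 : h ≤ H) (b : A) :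
    r s b h + ∑ s' : S, p s b s' * optVal p r (H - h) (h + 1) s' ≤
    r s (π s h) h + ∑ s' : S, p s (π s h) s' * optVal p r (H - h) (h + 1) s' := by
  have h3 := hπ h s h1 h2
  rw [show H + 1 - h = (H - h) + 1 by omega] at h3
  simp only [polVal, optVal] at h3
  have h4 : ∀ s', polVal p r π (H - h) (h + 1) s' = optVal p r (H - h) (h + 1) s' := by
    intro s'
    rcases Nat.lt_or_ge h H with h5 | h5
    · have := hπ (h + 1) s' (by omega) (by omega)
      rwa [show H + 1 - (h + 1) = H - h by omega] at this
    · rw [show H - h = 0 by omega]; rfl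
  simp only [h4] at h3
  rw [h3]
  exact le_ciSup (f := fun a : A => r s a h +
      ∑ s' : S, p s a s' * optVal p r (H - h) (h + 1) s') (Set.finite_range _).bddAbove b

theorem exp_shift {A : Type} [Fintype A] (η K : ℝ) (hη : 0 < η) (hK : 0 ≤ K) (Q : A → Prop)
    (w : A → ℝ) :
    expMeasure η {x | ∀ b, Q b → w b ≤ x} ≤
      ENNReal.ofReal (Real.exp (η * K)) * expMeasure η {x | ∀ b, Q b → w b + K < x} := by
  have hm1 : MeasurableSet {x : ℝ | ∀ b, Q b → w b ≤ x} := by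
    simp only [Set.ofPred_forall]
    exact MeasurableSet.iInter fun b => MeasurableSet.iInter fun _ => measurableSet_Ici
  have hm2 : MeasurableSet {x : ℝ | ∀ b, Q b → w b + K < x} := by
    simp only [Set.ofPred_forall]
    exact MeasurableSet.iInter fun b => MeasurableSet.iInter fun _ => measurableSet_Ioi
  have hE : expMeasure η = volume.withDensity (exponentialPDF η) := rfl
  rw [hE, withDensity_apply _ hm1, withDensity_apply _ hm2, ← lintegral_indicator hm1,
    ← lintegral_indicator hm2, ← lintegral_const_mul' _ _ ENNReal.ofReal_ne_top,
    ← lintegral_sub_right_eq_self _ K]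
  have hae : ∀ᵐ x : ℝ, ∀ b, x ≠ w b + K :=
    ae_all_iff.2 fun b => (Measure.ae_ne volume _)
  refine lintegral_mono_ae ?_
  filter_upwards [hae] with x hx
  by_cases hxB : x - K ∈ {x : ℝ | ∀ b, Q b → w b ≤ x}
  · have hxC : x ∈ {x : ℝ | ∀ b, Q b → w b + K < x} := by
      intro b hb
      have := hxB b hb
      exact lt_of_le_of_ne (by linarith) (hx b).symm
    rw [Set.indicator_of_mem hxB, Set.indicator_of_mem hxC, exponentialPDF_eq, exponentialPDF_eq,
      ← ENNReal.ofReal_mul (Real.exp_pos _).le]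
    refine ENNReal.ofReal_le_ofReal ?_
    split_ifs with g1 g2
    · rw [mul_left_comm, ← Real.exp_add]
      refine le_of_eq ?_
      congr 2
      ring
    · exact absurd (by linarith) g2
    · positivity
    · simp
  · rw [Set.indicator_of_notMem hxB]
    exact zero_le

theorem measurable_optVal {S A Y : Type} [Fintype S] [Fintype A] [Nonempty A] [MeasurableSpace Y]
    (p : S → A → S → ℝ) (r : Y → S → A → ℕ → ℝ)
    (hr : ∀ s a k, Measurable fun y => r y s a k) (n h : ℕ) (s : S) :
    Measurable fun y => optVal p (r y) n h s := by
  induction n generalizing h s with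
  | zero => simp only [optVal]; exact measurable_const
  | succ n ih =>
    simp only [optVal]
    refine Measurable.iSup fun a => ?_
    exact (hr s a h).add (Finset.measurable_sum _ fun s' _ => (ih _ _).const_mul _)

/-- Extend a finite perturbation table to all layers (by zero). -/
noncomputable def extRew {S A : Type} (H : ℕ) (y : S × A × Fin H → ℝ) : S → A → ℕ → ℝ :=
  fun s a h => if hh : 1 ≤ h ∧ h ≤ H then y (s, a, ⟨h - 1, by omega⟩) else 0

/-- State-action value. -/
noncomputable def qVal {S A : Type} [Fintype S] [Fintype A] [Nonempty A] (p : S → A → S → ℝ)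
    (r : S → A → ℕ → ℝ) (H h : ℕ) (s : S) (b : A) : ℝ :=
  r s b h + ∑ s' : S, p s b s' * optVal p r (H - h) (h + 1) s'

theorem qVal_le_add {S A : Type} [Fintype S] [Fintype A] [Nonempty A]
    (p : S → A → S → ℝ) (hp : IsKernel p) (r r' : S → A → ℕ → ℝ) (c : ℝ)
    (hrr : ∀ s a k, r s a k ≤ r' s a k + c) (H h : ℕ) (hH : h ≤ H) (s : S) (b : A) :
    qVal p r H h s b ≤ qVal p r' H h s b + ((H : ℝ) - h + 1) * c := by
  have h1 : ∑ s' : S, p s b s' * optVal p r (H - h) (h + 1) s' ≤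
        ∑ s' : S, p s b s' * optVal p r' (H - h) (h + 1) s' + ((H - h : ℕ) : ℝ) * c := by
      calc _ ≤ ∑ s' : S, p s b s' * (optVal p r' (H - h) (h + 1) s' + ((H - h : ℕ) : ℝ) * c) :=
            Finset.sum_le_sum fun s' _ => mul_le_mul_of_nonneg_left
              (optVal_le_add p hp r r' c hrr _ _ _) (hp.1 _ _ _)
        _ = _ := by
            simp only [mul_add, Finset.sum_add_distrib, ← Finset.sum_mul, hp.2, one_mul]
  have h3 := hrr s b h
  rw [Nat.cast_sub hH] at h1
  unfold qVal
  linarith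

theorem qVal_congr {S A : Type} [Fintype S] [Fintype A] [Nonempty A]
    (p : S → A → S → ℝ) (r r' : S → A → ℕ → ℝ) (H h : ℕ) (s : S) (b : A) (c : ℝ)
    (h0 : r s b h = c + r' s b h)
    (hrr : ∀ s a k, h < k → k ≤ H → r s a k = r' s a k) :
    qVal p r H h s b = c + qVal p r' H h s b := by
  unfold qVal
  rw [h0, add_assoc]
  congr 2
  refine Finset.sum_congr rfl fun s' _ => ?_
  rw [optVal_congr' p r r' (H - h) (h + 1) (fun s a k h1 h2 => hrr s a k (by omega) (by omega))]

theorem fpl_core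
    {S A : Type} [Fintype S] [Fintype A] [Nonempty A]
    {Ω : Type} [MeasurableSpace Ω] (P : Measure Ω) [IsProbabilityMeasure P]
    (H : ℕ) (p : S → A → S → ℝ) (hp : IsKernel p)
    (η : ℝ) (hη : 0 < η)
    (R0 : Ω → S → A → ℕ → ℝ)
    (hR0dist : ∀ s a h, 1 ≤ h → h ≤ H →
      Measure.map (fun ω => R0 ω s a h) P = expMeasure η)
    (hR0indep : iIndepFun
      (fun (x : S × A × Fin H) ω => R0 ω x.1 x.2.1 (x.2.2.val + 1)) P)
    (q q' : S → A → ℕ → ℝ) (δ : ℝ)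
    (hqq : ∀ s a h, q s a h + δ ≤ q' s a h ∧ q' s a h ≤ q s a h + δ + 1)
    (π π' : Ω → S → ℕ → A)
    (hπ : ∀ ω, IsOptimal p (fun s a h => R0 ω s a h + q s a h) H (π ω))
    (hπ' : ∀ ω, IsOptimal p (fun s a h => R0 ω s a h + q' s a h) H (π' ω))
    (s : S) (h : ℕ) (a : A) (h1 : 1 ≤ h) (h2 : h ≤ H) :
    (P {ω | π ω s h = a}).toReal
          ≤ Real.exp (η * ((H : ℝ) - h + 1)) * (P {ω | π' ω s h = a}).toReal := by
  classical
  set K : ℝ := (H : ℝ) - h + 1 with hKdef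
  have hK : 0 ≤ K := by
    have : (h : ℝ) ≤ H := by exact_mod_cast h2
    linarith
  have := isProbabilityMeasure_expMeasure hη
  set Z : S × A × Fin H → Ω → ℝ := fun x ω => R0 ω x.1 x.2.1 (x.2.2.val + 1) with hZ
  have hZm : ∀ x, AEMeasurable (Z x) P := by
    intro x
    refine AEMeasurable.of_map_ne_zero ?_
    have := hR0dist x.1 x.2.1 (x.2.2.val + 1) (by omega) (by omega)
    rw [hZ]
    simp only
    rw [this]
    exact IsProbabilityMeasure.ne_zero _
  set x0 : S × A × Fin H := (s, a, ⟨h - 1, by omega⟩) with hx0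
  set Y : Ω → (S × A × Fin H → ℝ) := fun ω => Function.update (fun x => Z x ω) x0 0 with hY
  have hXlaw : P.map (Z x0) = expMeasure η := by
    have := hR0dist s a h h1 h2
    rw [← this]
    congr 1
    funext ω
    simp [hZ, hx0, Nat.sub_add_cancel h1]
  have hYm : AEMeasurable Y P := by
    refine aemeasurable_pi_lambda _ fun x => ?_
    by_cases hx : x = x0
    · subst hx; simp [hY]
    · simpa [hY, Function.update_of_ne hx] using hZm x
  have hind : IndepFun (Z x0) Y P := by
    have h3 := hR0indep.indepFun_finset₀ {x0} ({x0}ᶜ) disjoint_compl_right hZm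
    have m1 : Measurable (fun f : ({x0} : Finset (S × A × Fin H)) → ℝ => f ⟨x0, by simp⟩) :=
      measurable_pi_apply _
    have m2 : Measurable (fun (f : ({x0}ᶜ : Finset (S × A × Fin H)) → ℝ) (x : S × A × Fin H) =>
        if hx : x = x0 then (0 : ℝ) else f ⟨x, by simpa using hx⟩) := by
      refine measurable_pi_lambda _ fun x => ?_
      by_cases hx : x = x0
      · simp only [hx, dif_pos]; exact measurable_const
      · simp only [hx, dif_neg, not_false_eq_true]; exact measurable_pi_apply _
    have h4 := h3.comp m1 m2
    convert h4 using 1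
    · rfl
    · funext ω x
      by_cases hx : x = x0
      · subst hx; simp [hY]
      · simp [hY, hx, hZ]
  have hmap := hind.map_prod_eq_prod_map_map (hZm x0) hYm
  rw [hXlaw] at hmap
  -- values as a function of the remaining coordinates
  set F : (S → A → ℕ → ℝ) → (S × A × Fin H → ℝ) → A → ℝ :=
    fun q y b => qVal p (fun s a h => extRew H y s a h + q s a h) H h s b with hF
  have hFm : ∀ q b, Measurable fun y => F q y b := by
    intro q b
    have hrm : ∀ s a k, Measurable fun y : S × A × Fin H → ℝ => extRew H y s a k + q s a k := by
      intro s a k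
      refine Measurable.add_const ?_ _
      unfold extRew
      split_ifs
      · exact measurable_pi_apply _
      · exact measurable_const
    simp only [hF, qVal]
    exact (hrm s b h).add (Finset.measurable_sum _ fun s' _ =>
      (measurable_optVal p _ hrm _ _ _).const_mul _)
  have hext : ∀ ω s' a' k, 1 ≤ k → k ≤ H → (s', a', k) ≠ (s, a, h) →
      R0 ω s' a' k = extRew H (Y ω) s' a' k := by
    intro ω s' a' k hk1 hk2 hne
    have hx : ((s', a', ⟨k - 1, by omega⟩) : S × A × Fin H) ≠ x0 := by
      intro hx
      apply hne
      simp only [hx0, Prod.mk.injEq, Fin.mk.injEq] at hx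
      simp only [Prod.mk.injEq]
      exact ⟨hx.1, hx.2.1, by omega⟩
    simp only [extRew, hk1, hk2, and_self, dif_pos, hY, Function.update_of_ne hx]
    simp [hZ, Nat.sub_add_cancel hk1]
  have hext0 : ∀ ω, extRew H (Y ω) s a h = 0 := by
    intro ω
    simp only [extRew, h1, h2, and_self, dif_pos, hY, hx0, Function.update_self]
  have hZ0 : ∀ ω, Z x0 ω = R0 ω s a h := by
    intro ω; simp [hZ, hx0, Nat.sub_add_cancel h1]
  have hQb : ∀ q ω b, b ≠ a →
      qVal p (fun s a h => R0 ω s a h + q s a h) H h s b = F q (Y ω) b := by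
    intro q ω b hb
    rw [← zero_add (F q (Y ω) b)]
    apply qVal_congr
    · rw [hext ω s b h h1 h2 (by simp [hb]), zero_add]
    · intro s' a' k hk1 hk2
      rw [hext ω s' a' k (by omega) hk2 (by simp; omega)]
  have hQa : ∀ q ω,
      qVal p (fun s a h => R0 ω s a h + q s a h) H h s a = Z x0 ω + F q (Y ω) a := by
    intro q ω
    apply qVal_congr
    · rw [hext0, hZ0, zero_add]
    · intro s' a' k hk1 hk2
      rw [hext ω s' a' k (by omega) hk2 (by simp; omega)]
  set G1 : Set (ℝ × (S × A × Fin H → ℝ)) :=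
    {z | ∀ b, b ≠ a → F q z.2 b - F q z.2 a ≤ z.1} with hG1
  set G2 : Set (ℝ × (S × A × Fin H → ℝ)) :=
    {z | ∀ b, b ≠ a → F q z.2 b - F q z.2 a + K < z.1} with hG2
  have hG1m : MeasurableSet G1 := by
    simp only [hG1, Set.ofPred_forall]
    refine MeasurableSet.iInter fun b => MeasurableSet.iInter fun _ => measurableSet_le ?_ ?_
    · exact ((hFm q b).comp measurable_snd).sub ((hFm q a).comp measurable_snd)
    · exact measurable_fst
  have hG2m : MeasurableSet G2 := by
    simp only [hG2, Set.ofPred_forall]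
    refine MeasurableSet.iInter fun b => MeasurableSet.iInter fun _ => measurableSet_lt ?_ ?_
    · exact (((hFm q b).comp measurable_snd).sub ((hFm q a).comp measurable_snd)).add_const _
    · exact measurable_fst
  have hpair : AEMeasurable (fun ω => (Z x0 ω, Y ω)) P := (hZm x0).prodMk hYm
  have hYprob : IsProbabilityMeasure (P.map Y) := Measure.isProbabilityMeasure_map hYm
  have e1 : P {ω | π ω s h = a} ≤ P ((fun ω => (Z x0 ω, Y ω)) ⁻¹' G1) := by
    refine measure_mono fun ω hω b hb => ?_
    have h3 := (hπ ω).le_of p _ H _ s h h1 h2 b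
    have hω' : π ω s h = a := hω
    rw [hω'] at h3
    change qVal p (fun s a h => R0 ω s a h + q s a h) H h s b ≤
      qVal p (fun s a h => R0 ω s a h + q s a h) H h s a at h3
    rw [hQa, hQb _ _ _ hb] at h3
    simp only
    linarith
  have e2 : P ((fun ω => (Z x0 ω, Y ω)) ⁻¹' G2) ≤ P {ω | π' ω s h = a} := by
    refine measure_mono fun ω hω => ?_
    by_contra hne
    have hne' : π' ω s h ≠ a := hne
    have h3 := (hπ' ω).le_of p _ H _ s h h1 h2 a
    change qVal p (fun s a h => R0 ω s a h + q' s a h) H h s a ≤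
      qVal p (fun s a h => R0 ω s a h + q' s a h) H h s (π' ω s h) at h3
    have h4 := hω (π' ω s h) hne'
    simp only at h4
    have h5 := qVal_le_add p hp (fun s a h => R0 ω s a h + q' s a h)
      (fun s a h => R0 ω s a h + q s a h) (δ + 1)
      (fun s a k => by have := (hqq s a k).2; linarith) H h h2 s (π' ω s h)
    have h6 := qVal_le_add p hp (fun s a h => R0 ω s a h + q s a h)
      (fun s a h => R0 ω s a h + q' s a h) (-δ)
      (fun s a k => by have := (hqq s a k).1; linarith) H h h2 s a
    rw [hQb q _ _ hne'] at h5
    rw [hQa q] at h6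
    rw [← hKdef] at h5 h6
    linarith
  have e3 : ((expMeasure η).prod (P.map Y)) G1 ≤
      ENNReal.ofReal (Real.exp (η * K)) * ((expMeasure η).prod (P.map Y)) G2 := by
    rw [Measure.prod_apply_symm hG1m, Measure.prod_apply_symm hG2m,
      ← lintegral_const_mul' _ _ ENNReal.ofReal_ne_top]
    refine lintegral_mono fun y => ?_
    exact exp_shift η K hη hK (fun b => b ≠ a) (fun b => F q y b - F q y a)
  rw [← hmap, Measure.map_apply_of_aemeasurable hpair hG1m,
    Measure.map_apply_of_aemeasurable hpair hG2m] at e3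
  have e4 : P {ω | π ω s h = a} ≤
      ENNReal.ofReal (Real.exp (η * K)) * P {ω | π' ω s h = a} :=
    e1.trans (e3.trans (mul_le_mul_right e2 _))
  have e5 := ENNReal.toReal_mono
    (ENNReal.mul_ne_top ENNReal.ofReal_ne_top (measure_ne_top P _)) e4
  rwa [ENNReal.toReal_mul, ENNReal.toReal_ofReal (Real.exp_pos _).le] at e5
/-- Under the FPL algorithm with parameter `η > 0`, for every episode `t`,
state `s`, layer `h`, and action `a`, the probabilities (over the random perturbation `r₀`)
of the chosen action satisfy
`e^{−η(H−h+1)} ≤ Pr[π_t(s,h) = a] / Pr[π_{t+1}(s,h) = a] ≤ e^{η(H−h+1)}`,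
stated here in the equivalent multiplicative (division-free) form. -/
theorem fpl_action_probability_stability
    {S A : Type} [Fintype S] [Fintype A] [Nonempty S] [Nonempty A]
    {Ω : Type} [MeasurableSpace Ω] (P : Measure Ω) [IsProbabilityMeasure P]
    (H T : ℕ) (hH : 0 < H) (hT : 0 < T) (s₁ : S)
    (p : S → A → S → ℝ) (hp : IsKernel p)
    (η : ℝ) (hη : 0 < η)
    (r : ℕ → S → A → ℕ → ℝ) (hr : ∀ t s a h, 0 ≤ r t s a h ∧ r t s a h ≤ 1)
    (R0 : Ω → S → A → ℕ → ℝ)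
    (hR0dist : ∀ s a h, 1 ≤ h → h ≤ H →
      Measure.map (fun ω => R0 ω s a h) P = expMeasure η)
    (hR0indep : iIndepFun
      (fun (x : S × A × Fin H) ω => R0 ω x.1 x.2.1 (x.2.2.val + 1)) P)
    (π : ℕ → Ω → S → ℕ → A)
    (hπopt : ∀ t ω, IsOptimal p
      (fun s a h => R0 ω s a h + ∑ τ ∈ Finset.Icc 1 (t - 1), r τ s a h) H (π t ω))
    (hπmeas : ∀ t s h a, MeasurableSet {ω | π t ω s h = a}) :
    ∀ t s h a, 1 ≤ t → t ≤ T → 1 ≤ h → h ≤ H →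
      (P {ω | π t ω s h = a}).toReal
          ≤ Real.exp (η * ((H : ℝ) - h + 1)) * (P {ω | π (t + 1) ω s h = a}).toReal ∧
      (P {ω | π (t + 1) ω s h = a}).toReal
          ≤ Real.exp (η * ((H : ℝ) - h + 1)) * (P {ω | π t ω s h = a}).toReal := by
  intro t s h a ht _ h1 h2
  have hsum : ∀ s a h, ∑ τ ∈ Finset.Icc 1 (t + 1 - 1), r τ s a h =
      ∑ τ ∈ Finset.Icc 1 (t - 1), r τ s a h + r t s a h := by
    intro s a h
    obtain ⟨u, rfl⟩ : ∃ u, t = u + 1 := ⟨t - 1, by omega⟩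
    simp only [Nat.add_sub_cancel]
    rw [Finset.sum_Icc_succ_top (by omega)]
  refine ⟨fpl_core P H p hp η hη R0 hR0dist hR0indep _ _ 0 ?_ _ _ (hπopt t) (hπopt (t + 1))
      s h a h1 h2,
    fpl_core P H p hp η hη R0 hR0dist hR0indep _ _ (-1) ?_ _ _ (hπopt (t + 1)) (hπopt t)
      s h a h1 h2⟩
  · intro s a h
    have := hr t s a h
    simp only [hsum]
    constructor <;> linarith
  · intro s a h
    have := hr t s a h
    simp only [hsum]
    constructor <;> linarith
end

section
/- Under the FPL algorithm with parameter η > 0, for every episode t and every trajectory (s_1, a_1, …, s_H, a_H), the probability of experiencing that trajectory (over the random perturbation r_0 and the MDP's transition randomness) under π_t and under π_{t+1} satisfies Pr_{π_t}[s_1, a_1, …, s_H, a_H] / Pr_{π_{t+1}}[s_1, a_1, …, s_H, a_H] ∈ [e^{−ηH²}, e^{ηH²}]. -/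
open MeasureTheory ProbabilityTheory

/-- The probability that a trajectory started at `st 1` and following the random policy
`π` (random through `ω`) visits exactly the states `st 1, …, st H` and takes exactly the
actions `ac 1, …, ac H`: the policy must select the prescribed action at every layer, and
every prescribed transition must occur. -/
noncomputable def trajProb {S A : Type} [Fintype S] [Fintype A]
    {Ω : Type} [MeasurableSpace Ω] (P : Measure Ω)
    (p : S → A → S → ℝ) (π : Ω → S → ℕ → A) (H : ℕ)
    (st : ℕ → S) (ac : ℕ → A) : ℝ :=
  (P {ω | ∀ h, 1 ≤ h → h ≤ H → π ω (st h) h = ac h}).toReal *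
    ∏ h ∈ Finset.Icc 1 (H - 1), p (st h) (ac h) (st (h + 1))


lemma exp_shift_lintegral (η : ℝ) (hη : 0 < η) (δ d : ℝ) (h0 : 0 ≤ δ) (hd : δ ≤ d)
    (f : ℝ → ENNReal) (hf : Measurable f) :
    ∫⁻ y, f (y + δ) ∂(expMeasure η) ≤
      ENNReal.ofReal (Real.exp (η * d)) * ∫⁻ y, f y ∂(expMeasure η) := by
  have hm : Measurable (exponentialPDF η) :=
    (measurable_exponentialPDFReal η).ennreal_ofReal
  have he : expMeasure η = volume.withDensity (exponentialPDF η) := rfl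
  have hf' : Measurable (fun y => f (y + δ)) := hf.comp (measurable_add_const δ)
  rw [he, lintegral_withDensity_eq_lintegral_mul _ hm hf',
    lintegral_withDensity_eq_lintegral_mul _ hm hf, ← lintegral_const_mul _ (hm.mul hf),
    ← lintegral_sub_right_eq_self _ δ]
  refine lintegral_mono fun y => ?_
  simp only [Pi.mul_apply, sub_add_cancel, Function.comp]
  rw [← mul_assoc]
  gcongr
  rcases lt_or_ge (y - δ) 0 with hy | hy
  · rw [exponentialPDF_of_neg hy]; exact zero_le
  · rw [exponentialPDF_of_nonneg hy, exponentialPDF_of_nonneg (by linarith),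
      ← ENNReal.ofReal_mul (Real.exp_pos _).le]
    apply ENNReal.ofReal_le_ofReal
    have : Real.exp (-(η * (y - δ))) ≤ Real.exp (η * d) * Real.exp (-(η * y)) := by
      rw [← Real.exp_add]
      apply Real.exp_le_exp.mpr
      nlinarith
    nlinarith

open Classical in
lemma pi_shift_single {ι : Type} [Fintype ι] (η : ℝ) (hη : 0 < η) (i : ι) (d : ℝ)
    (δ : (ι → ℝ) → ℝ) (hδ : Measurable δ) (h0 : ∀ x, 0 ≤ δ x) (hd : ∀ x, δ x ≤ d)
    (hi : ∀ x v, δ (Function.update x i v) = δ x) (B : Set (ι → ℝ)) (hB : MeasurableSet B) :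
    Measure.pi (fun _ : ι => expMeasure η) {x | Function.update x i (x i + δ x) ∈ B} ≤
      ENNReal.ofReal (Real.exp (η * d)) * Measure.pi (fun _ : ι => expMeasure η) B := by
  have : IsProbabilityMeasure (expMeasure η) := isProbabilityMeasure_expMeasure hη
  have hT : Measurable (fun x : ι → ℝ => Function.update x i (x i + δ x)) := by
    rw [measurable_pi_iff]
    intro j
    by_cases hj : j = i
    · subst hj; simp only [Function.update_self]; exact (measurable_pi_apply j).add hδ
    · simpa [Function.update_of_ne hj] using measurable_pi_apply j
  have hS : MeasurableSet {x : ι → ℝ | Function.update x i (x i + δ x) ∈ B} := hT hB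
  rw [← lintegral_indicator_one hS, ← lintegral_indicator_one hB,
    ← lintegral_const_mul _ (measurable_one.indicator hB)]
  have x0 : ι → ℝ := fun _ => 0
  rw [lintegral_eq_lmarginal_univ x0, lintegral_eq_lmarginal_univ x0]
  refine lmarginal_le_of_subset (Finset.subset_univ {i}) (measurable_one.indicator hS)
    ((measurable_one.indicator hB).const_mul _) ?_ x0
  rw [lmarginal_singleton, lmarginal_singleton]
  intro x
  simp only
  have hg : Measurable (fun v : ℝ => B.indicator (1 : (ι → ℝ) → ENNReal) (Function.update x i v)) :=
    (measurable_one.indicator hB).comp (measurable_update x)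
  rw [lintegral_const_mul _ hg]
  refine le_trans (le_of_eq ?_) (exp_shift_lintegral η hη (δ x) d (h0 x) (hd x) _ hg)
  refine lintegral_congr fun v => ?_
  simp [Set.indicator, hi]

open Classical in
/-- Successive coordinate shifts. -/
noncomputable def shiftT {ι : Type} (key : ℕ → ι) (δ : ℕ → (ι → ℝ) → ℝ) :
    ℕ → (ι → ℝ) → (ι → ℝ)
  | 0, x => x
  | k + 1, x => Function.update (shiftT key δ k x) (key k)
      (shiftT key δ k x (key k) + δ k (shiftT key δ k x))

open Classical in
lemma shiftT_apply {ι : Type} (key : ℕ → ι) (δ : ℕ → (ι → ℝ) → ℝ) (H : ℕ)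
    (hloc : ∀ j < H, ∀ x y, (∀ i, (∀ m ≤ j, key m ≠ i) → x i = y i) → δ j x = δ j y)
    (k : ℕ) (hk : k ≤ H) (x : ι → ℝ) (i : ι) :
    shiftT key δ k x i = x i + ∑ m ∈ Finset.range k, if key m = i then δ m x else 0 := by
  induction k generalizing i with
  | zero => simp [shiftT]
  | succ k ih =>
    have e : δ k (shiftT key δ k x) = δ k x := by
      apply hloc k hk
      intro i hi
      rw [ih (by omega), Finset.sum_eq_zero, add_zero]
      intro m hm
      rw [if_neg (hi m (by simp at hm; omega))]
    rw [shiftT, Finset.sum_range_succ, e]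
    by_cases h : key k = i
    · subst h; simp [ih (by omega)]; ring
    · rw [Function.update_of_ne (Ne.symm h), ih (by omega)]; simp [h]

lemma pi_shiftT {ι : Type} [Fintype ι] (η : ℝ) (hη : 0 < η) (key : ℕ → ι)
    (δ : ℕ → (ι → ℝ) → ℝ) (d : ℕ → ℝ) (H : ℕ)
    (hδ : ∀ j < H, Measurable (δ j)) (h0 : ∀ j < H, ∀ x, 0 ≤ δ j x)
    (hd : ∀ j < H, ∀ x, δ j x ≤ d j)
    (hloc : ∀ j < H, ∀ x y, (∀ i, (∀ m ≤ j, key m ≠ i) → x i = y i) → δ j x = δ j y)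
    (k : ℕ) (hk : k ≤ H) (B : Set (ι → ℝ)) (hB : MeasurableSet B) :
    Measure.pi (fun _ : ι => expMeasure η) {x | shiftT key δ k x ∈ B} ≤
      ENNReal.ofReal (Real.exp (η * ∑ j ∈ Finset.range k, d j)) *
        Measure.pi (fun _ : ι => expMeasure η) B := by
  classical
  induction k generalizing B with
  | zero => simp [shiftT]
  | succ k ih =>
    have hT : Measurable (fun x : ι → ℝ => Function.update x (key k) (x (key k) + δ k x)) := by
      rw [measurable_pi_iff]
      intro j
      by_cases hj : j = key k
      · subst hj; simp only [Function.update_self]; exact (measurable_pi_apply _).add (hδ k hk)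
      · simpa [Function.update_of_ne hj] using measurable_pi_apply j
    have h1 := ih (by omega) _ (hT hB)
    have h2 := pi_shift_single η hη (key k) (d k) (δ k) (hδ k hk) (h0 k hk) (hd k hk)
      (by
        intro x v
        apply hloc k hk
        intro i hi
        rw [Function.update_of_ne (Ne.symm (hi k le_rfl))]) B hB
    have e : {x | shiftT key δ (k+1) x ∈ B} = {x | shiftT key δ k x ∈
      (fun x : ι → ℝ => Function.update x (key k) (x (key k) + δ k x)) ⁻¹' B} := by
      ext x
      simp only [shiftT, Set.mem_ofPred_eq, Set.mem_preimage]
    rw [e]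
    refine h1.trans ?_
    rw [Finset.sum_range_succ, mul_add, Real.exp_add, ENNReal.ofReal_mul (Real.exp_pos _).le,
      mul_assoc]
    gcongr
    exact h2

section Det

variable {S A : Type} [Fintype S] [Fintype A] [Nonempty A]

/-- The optimal action-value. -/
noncomputable def Qf (p : S → A → S → ℝ) (ρ : S → A → ℕ → ℝ) (n h : ℕ) (s : S) (a : A) : ℝ :=
  ρ s a h + ∑ s' : S, p s a s' * optVal p ρ n (h + 1) s'

lemma optVal_succ (p : S → A → S → ℝ) (ρ : S → A → ℕ → ℝ) (n h : ℕ) (s : S) :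
    optVal p ρ (n + 1) h s = ⨆ a : A, Qf p ρ n h s a := rfl

lemma optVal_congr (p : S → A → S → ℝ) (ρ ρ' : S → A → ℕ → ℝ) (n h : ℕ)
    (hh : ∀ s a j, h ≤ j → j < h + n → ρ s a j = ρ' s a j) (s : S) :
    optVal p ρ n h s = optVal p ρ' n h s := by
  induction n generalizing h s with
  | zero => rfl
  | succ n ih =>
    rw [optVal_succ, optVal_succ]
    congr 1; ext a
    unfold Qf
    rw [hh s a h le_rfl (by omega)]
    congr 1
    refine Finset.sum_congr rfl fun s' _ => ?_
    rw [ih (h + 1) (fun s a j h1 h2 => hh s a j (by omega) (by omega))]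

lemma Qf_congr (p : S → A → S → ℝ) (ρ ρ' : S → A → ℕ → ℝ) (n h : ℕ)
    (hh : ∀ s a j, h ≤ j → j < h + (n + 1) → ρ s a j = ρ' s a j) (s : S) (a : A) :
    Qf p ρ n h s a = Qf p ρ' n h s a := by
  unfold Qf
  rw [hh s a h le_rfl (by omega)]
  congr 1
  refine Finset.sum_congr rfl fun s' _ => ?_
  rw [optVal_congr p ρ ρ' n (h + 1) (fun s a j h1 h2 => hh s a j (by omega) (by omega))]

lemma IsOptimal.ge {p : S → A → S → ℝ} {ρ : S → A → ℕ → ℝ} {H : ℕ} {π : S → ℕ → A}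
    (ho : IsOptimal p ρ H π) (h : ℕ) (h1 : 1 ≤ h) (h2 : h ≤ H) (s : S) (a : A) :
    Qf p ρ (H - h) h s a ≤ Qf p ρ (H - h) h s (π s h) := by
  have e : H + 1 - h = (H - h) + 1 := by omega
  have := ho h s h1 h2
  rw [e, optVal_succ] at this
  have e2 : polVal p ρ π (H - h + 1) h s = Qf p ρ (H - h) h s (π s h) := by
    unfold Qf
    rw [polVal]
    congr 1
    refine Finset.sum_congr rfl fun s' _ => ?_
    congr 1
    rcases Nat.lt_or_ge h H with hl | hl
    · have := ho (h + 1) s' (by omega) hl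
      rwa [show H + 1 - (h + 1) = H - h by omega] at this
    · rw [show H - h = 0 by omega]; rfl
  rw [← e2, this]
  exact le_ciSup (f := fun a => Qf p ρ (H - h) h s a) (Set.finite_range _).bddAbove a

variable (p : S → A → S → ℝ) (st : ℕ → S) (ac : ℕ → A) (hi : ℝ) (r : S → A → ℕ → ℝ)

open Classical in
/-- Optimal value after the change of rewards and of the perturbation. -/
noncomputable def newV (ρ : S → A → ℕ → ℝ) : ℕ → ℕ → S → ℝ
  | 0, _, _ => 0
  | n + 1, h, s => ⨆ a : A, if s = st h ∧ a = ac h then Qf p ρ n h s a + (n + 1) * hi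
      else ρ s a h + r s a h + ∑ s' : S, p s a s' * newV ρ n (h + 1) s'

/-- The shift of the perturbation on the trajectory. -/
noncomputable def dl (ρ : S → A → ℕ → ℝ) (n h : ℕ) : ℝ :=
  (n + 1) * hi - r (st h) (ac h) h - ∑ s' : S, p (st h) (ac h) s' *
    (newV p st ac hi r ρ n (h + 1) s' - optVal p ρ n (h + 1) s')

lemma newV_congr (ρ ρ' : S → A → ℕ → ℝ) (n h : ℕ)
    (hh : ∀ s a j, h ≤ j → j < h + n → ρ s a j = ρ' s a j) (s : S) :
    newV p st ac hi r ρ n h s = newV p st ac hi r ρ' n h s := by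
  induction n generalizing h s with
  | zero => rfl
  | succ n ih =>
    rw [newV, newV]
    congr 1; ext a
    rw [Qf_congr p ρ ρ' n h hh, hh s a h le_rfl (by omega)]
    congr 2
    refine Finset.sum_congr rfl fun s' _ => ?_
    rw [ih (h + 1) (fun s a j h1 h2 => hh s a j (by omega) (by omega))]

lemma dl_congr (ρ ρ' : S → A → ℕ → ℝ) (n h : ℕ)
    (hh : ∀ s a j, h + 1 ≤ j → j < h + 1 + n → ρ s a j = ρ' s a j) :
    dl p st ac hi r ρ n h = dl p st ac hi r ρ' n h := by
  unfold dl
  congr 1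
  refine Finset.sum_congr rfl fun s' _ => ?_
  rw [newV_congr p st ac hi r ρ ρ' n (h + 1) hh, optVal_congr p ρ ρ' n (h + 1) hh]

lemma avg_bounds (hp : IsKernel p) (s : S) (a : A) (f : S → ℝ) (l u : ℝ)
    (hl : ∀ s, l ≤ f s) (hu : ∀ s, f s ≤ u) :
    l ≤ ∑ s', p s a s' * f s' ∧ ∑ s', p s a s' * f s' ≤ u := by
  have e : ∀ c : ℝ, ∑ s', p s a s' * c = c := fun c => by
    rw [← Finset.sum_mul, hp.2, one_mul]
  constructor
  · rw [← e l]
    exact Finset.sum_le_sum fun s' _ => mul_le_mul_of_nonneg_left (hl s') (hp.1 s a s')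
  · conv_rhs => rw [← e u]
    exact Finset.sum_le_sum fun s' _ => mul_le_mul_of_nonneg_left (hu s') (hp.1 s a s')

lemma sup_bounds (f g : A → ℝ) (l u : ℝ) (hl : ∀ a, l ≤ g a - f a) (hu : ∀ a, g a - f a ≤ u) :
    l ≤ (⨆ a, g a) - (⨆ a, f a) ∧ (⨆ a, g a) - (⨆ a, f a) ≤ u := by
  have hg : ∀ a, g a ≤ ⨆ a, g a := fun a => le_ciSup (Set.finite_range _).bddAbove a
  have hf : ∀ a, f a ≤ ⨆ a, f a := fun a => le_ciSup (Set.finite_range _).bddAbove a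
  have h1 : (⨆ a, f a) ≤ (⨆ a, g a) - l := ciSup_le fun a => by linarith [hg a, hl a]
  have h2 : (⨆ a, g a) ≤ (⨆ a, f a) + u := ciSup_le fun a => by linarith [hf a, hu a]
  constructor <;> linarith

lemma newV_bounds (hp : IsKernel p) (lo : ℝ) (hlo : ∀ s a h, lo ≤ r s a h)
    (hhi : ∀ s a h, r s a h < hi) (ρ : S → A → ℕ → ℝ) (n h : ℕ) (s : S) :
    n * lo ≤ newV p st ac hi r ρ n h s - optVal p ρ n h s ∧
    newV p st ac hi r ρ n h s - optVal p ρ n h s ≤ n * hi := by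
  induction n generalizing h s with
  | zero => simp [newV, optVal]
  | succ n ih =>
    rw [newV, optVal_succ]
    push_cast
    have lohi : lo < hi := (hlo s (Classical.arbitrary A) h).trans_lt (hhi _ _ _)
    have key : ∀ a : A, ¬ (s = st h ∧ a = ac h) →
      (n + 1) * lo ≤ (ρ s a h + r s a h + ∑ s' : S, p s a s' * newV p st ac hi r ρ n (h + 1) s')
        - Qf p ρ n h s a ∧
      (ρ s a h + r s a h + ∑ s' : S, p s a s' * newV p st ac hi r ρ n (h + 1) s')
        - Qf p ρ n h s a ≤ (n + 1) * hi := by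
      intro a _
      have := avg_bounds p hp s a _ _ _ (fun s => (ih (h + 1) s).1) (fun s => (ih (h + 1) s).2)
      simp only [mul_sub, Finset.sum_sub_distrib] at this
      unfold Qf
      constructor <;> nlinarith [hlo s a h, hhi s a h]
    have pos : (n + 1 : ℝ) * lo ≤ (n + 1) * hi := by
      apply mul_le_mul_of_nonneg_left lohi.le; positivity
    apply sup_bounds
    · intro a
      split_ifs with hc
      · linarith
      · exact (key a hc).1
    · intro a
      split_ifs with hc
      · linarith
      · exact (key a hc).2

lemma dl_bounds (hp : IsKernel p) (lo : ℝ) (hlo : ∀ s a h, lo ≤ r s a h)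
    (hhi : ∀ s a h, r s a h < hi) (ρ : S → A → ℕ → ℝ) (n h : ℕ) :
    0 ≤ dl p st ac hi r ρ n h ∧ dl p st ac hi r ρ n h ≤ (n + 1) * (hi - lo) := by
  have := avg_bounds p hp (st h) (ac h) _ _ _
    (fun s => (newV_bounds p st ac hi r hp lo hlo hhi ρ n (h + 1) s).1)
    (fun s => (newV_bounds p st ac hi r hp lo hlo hhi ρ n (h + 1) s).2)
  unfold dl
  constructor <;> nlinarith [hlo (st h) (ac h) h, hhi (st h) (ac h) h]

open Classical in
lemma newV_eq (H : ℕ) (ρ ρ' : S → A → ℕ → ℝ)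
    (hρ : ∀ s a h, 1 ≤ h → h ≤ H → ρ' s a h = ρ s a h + r s a h +
      if s = st h ∧ a = ac h then dl p st ac hi r ρ (H - h) h else 0)
    (n h : ℕ) (h1 : 1 ≤ h) (hn : n + h = H + 1) (s : S) :
    optVal p ρ' n h s = newV p st ac hi r ρ n h s := by
  induction n generalizing h s with
  | zero => rfl
  | succ n ih =>
    rw [optVal_succ, newV]
    congr 1; ext a
    unfold Qf
    rw [hρ s a h h1 (by omega)]
    simp_rw [ih (h + 1) (by omega) (by omega)]
    split_ifs with hc
    · obtain ⟨rfl, rfl⟩ := hc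
      rw [show H - h = n by omega]
      unfold dl
      simp only [mul_sub, Finset.sum_sub_distrib]
      ring
    · ring

open Classical in
lemma strict_of_weak (hp : IsKernel p) (lo : ℝ) (hlo : ∀ s a h, lo ≤ r s a h)
    (hhi : ∀ s a h, r s a h < hi) (H : ℕ) (ρ ρ' : S → A → ℕ → ℝ)
    (hρ : ∀ s a h, 1 ≤ h → h ≤ H → ρ' s a h = ρ s a h + r s a h +
      if s = st h ∧ a = ac h then dl p st ac hi r ρ (H - h) h else 0)
    (h : ℕ) (h1 : 1 ≤ h) (h2 : h ≤ H)
    (hw : ∀ a, Qf p ρ (H - h) h (st h) a ≤ Qf p ρ (H - h) h (st h) (ac h))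
    (a : A) (ha : a ≠ ac h) :
    Qf p ρ' (H - h) h (st h) a < Qf p ρ' (H - h) h (st h) (ac h) := by
  have hv : ∀ s, optVal p ρ' (H - h) (h + 1) s = newV p st ac hi r ρ (H - h) (h + 1) s :=
    newV_eq p st ac hi r H ρ ρ' hρ _ _ (by omega) (by omega)
  have hw := hw a
  have hb := (avg_bounds p hp (st h) a _ _ _
    (fun s => (newV_bounds p st ac hi r hp lo hlo hhi ρ (H - h) (h + 1) s).1)
    (fun s => (newV_bounds p st ac hi r hp lo hlo hhi ρ (H - h) (h + 1) s).2)).2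
  unfold Qf at *
  rw [hρ _ _ h h1 h2, hρ _ _ h h1 h2]
  simp_rw [hv]
  simp only [ha, and_false, if_false, and_self, if_true]
  unfold dl
  simp only [mul_sub, Finset.sum_sub_distrib] at *
  linarith [hhi (st h) a h]

end Det

section Meas

variable {S A : Type} [Fintype S] [Fintype A] [Nonempty A] {X : Type} [MeasurableSpace X]

lemma measurable_optVal_s4 (p : S → A → S → ℝ) (ρ : X → S → A → ℕ → ℝ)
    (hρ : ∀ s a h, Measurable (fun x => ρ x s a h)) (n h : ℕ) (s : S) :
    Measurable (fun x => optVal p (ρ x) n h s) := by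
  induction n generalizing h s with
  | zero => exact measurable_const
  | succ n ih =>
    simp only [optVal]
    exact Measurable.iSup fun a => (hρ s a h).add
      (Finset.measurable_sum _ fun s' _ => (ih (h + 1) s').const_mul _)

lemma measurable_Qf (p : S → A → S → ℝ) (ρ : X → S → A → ℕ → ℝ)
    (hρ : ∀ s a h, Measurable (fun x => ρ x s a h)) (n h : ℕ) (s : S) (a : A) :
    Measurable (fun x => Qf p (ρ x) n h s a) :=
  (hρ s a h).add
      (Finset.measurable_sum _ fun s' _ => (measurable_optVal_s4 p ρ hρ n (h + 1) s').const_mul _)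

lemma measurable_newV (p : S → A → S → ℝ) (st : ℕ → S) (ac : ℕ → A) (hi : ℝ)
    (r : S → A → ℕ → ℝ) (ρ : X → S → A → ℕ → ℝ)
    (hρ : ∀ s a h, Measurable (fun x => ρ x s a h)) (n h : ℕ) (s : S) :
    Measurable (fun x => newV p st ac hi r (ρ x) n h s) := by
  induction n generalizing h s with
  | zero => exact measurable_const
  | succ n ih =>
    simp only [newV]
    refine Measurable.iSup fun a => ?_
    split_ifs
    · exact (measurable_Qf p ρ hρ n h s a).add_const _
    · exact ((hρ s a h).add_const _).add
        (Finset.measurable_sum _ fun s' _ => (ih (h + 1) s').const_mul _)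

lemma measurable_dl (p : S → A → S → ℝ) (st : ℕ → S) (ac : ℕ → A) (hi : ℝ)
    (r : S → A → ℕ → ℝ) (ρ : X → S → A → ℕ → ℝ)
    (hρ : ∀ s a h, Measurable (fun x => ρ x s a h)) (n h : ℕ) :
    Measurable (fun x => dl p st ac hi r (ρ x) n h) := by
  unfold dl
  exact measurable_const.sub (Finset.measurable_sum _ fun s' _ =>
    ((measurable_newV p st ac hi r ρ hρ n (h + 1) s').sub
      (measurable_optVal_s4 p ρ hρ n (h + 1) s')).const_mul _)

end Meas

/-- Rewards from a vector of perturbations and a deterministic part. -/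
def extR {S A : Type} {H : ℕ} (hH : 0 < H) (c : S → A → ℕ → ℝ) (x : S × A × Fin H → ℝ) :
    S → A → ℕ → ℝ :=
  fun s a h => x (s, a, ⟨(h - 1) % H, Nat.mod_lt _ hH⟩) + c s a h

/-- Perturbations for which the trajectory is strictly optimal. -/
def strictSet {S A : Type} [Fintype S] [Fintype A] [Nonempty A] {H : ℕ} (hH : 0 < H)
    (p : S → A → S → ℝ) (st : ℕ → S) (ac : ℕ → A) (c : S → A → ℕ → ℝ) :
    Set (S × A × Fin H → ℝ) :=
  {x | ∀ h, 1 ≤ h → h ≤ H → ∀ a, a ≠ ac h →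
    Qf p (extR hH c x) (H - h) h (st h) a < Qf p (extR hH c x) (H - h) h (st h) (ac h)}

/-- Perturbations for which the trajectory is weakly optimal. -/
def weakSet {S A : Type} [Fintype S] [Fintype A] [Nonempty A] {H : ℕ} (hH : 0 < H)
    (p : S → A → S → ℝ) (st : ℕ → S) (ac : ℕ → A) (c : S → A → ℕ → ℝ) :
    Set (S × A × Fin H → ℝ) :=
  {x | ∀ h, 1 ≤ h → h ≤ H → ∀ a,
    Qf p (extR hH c x) (H - h) h (st h) a ≤ Qf p (extR hH c x) (H - h) h (st h) (ac h)}

section Final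

variable {S A : Type} [Fintype S] [Fintype A] [Nonempty A] {H : ℕ} (hH : 0 < H)
    (p : S → A → S → ℝ) (st : ℕ → S) (ac : ℕ → A)

lemma measurable_extR (c : S → A → ℕ → ℝ) (s : S) (a : A) (h : ℕ) :
    Measurable (fun x => extR hH c x s a h) :=
  (measurable_pi_apply _).add_const _

lemma measurableSet_strictSet (c : S → A → ℕ → ℝ) : MeasurableSet (strictSet hH p st ac c) := by
  unfold strictSet
  simp only [Set.ofPred_forall]
  refine MeasurableSet.iInter fun h => MeasurableSet.iInter fun _ => MeasurableSet.iInter fun _ =>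
    MeasurableSet.iInter fun a => MeasurableSet.iInter fun _ => ?_
  exact measurableSet_lt (measurable_Qf p _ (measurable_extR hH c) _ _ _ _)
    (measurable_Qf p _ (measurable_extR hH c) _ _ _ _)

lemma weak_le_strict (hp : IsKernel p) (η : ℝ) (hη : 0 < η) (lo hi : ℝ) (r c c' : S → A → ℕ → ℝ)
    (hlo : ∀ s a h, lo ≤ r s a h) (hhi : ∀ s a h, r s a h < hi) (hlohi : lo ≤ hi)
    (hc : ∀ s a h, c' s a h = c s a h + r s a h) :
    Measure.pi (fun _ : S × A × Fin H => expMeasure η) (weakSet hH p st ac c) ≤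
      ENNReal.ofReal (Real.exp (η * (H ^ 2 * (hi - lo)))) *
      Measure.pi (fun _ : S × A × Fin H => expMeasure η) (strictSet hH p st ac c') := by
  classical
  set key : ℕ → S × A × Fin H :=
    fun j => (st (j + 1), ac (j + 1), ⟨j % H, Nat.mod_lt _ hH⟩) with hkey
  set δ : ℕ → (S × A × Fin H → ℝ) → ℝ :=
    fun j x => dl p st ac hi r (extR hH c x) (H - (j + 1)) (j + 1) with hδ
  have hloc : ∀ j < H, ∀ x y, (∀ i, (∀ m ≤ j, key m ≠ i) → x i = y i) → δ j x = δ j y := by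
    intro j hj x y hxy
    apply dl_congr
    intro s a k hk1 hk2
    unfold extR
    congr 1
    apply hxy
    intro m hm heq
    simp only [hkey, Prod.mk.injEq, Fin.mk.injEq] at heq
    have := heq.2.2
    rw [Nat.mod_eq_of_lt (by omega), Nat.mod_eq_of_lt (by omega)] at this
    omega
  have hb := fun j x => dl_bounds p st ac hi r hp lo hlo hhi (extR hH c x) (H - (j + 1)) (j + 1)
  have hd : ∀ j < H, ∀ x, δ j x ≤ (fun _ => (H : ℝ) * (hi - lo)) j := by
    intro j hj x
    refine (hb j x).2.trans ?_
    apply mul_le_mul_of_nonneg_right _ (by linarith)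
    have : H - (j + 1) + 1 ≤ H := by omega
    exact_mod_cast this
  have main := pi_shiftT η hη key δ (fun _ => (H : ℝ) * (hi - lo)) H
    (fun j _ => measurable_dl p st ac hi r _ (measurable_extR hH c) _ _)
    (fun j _ x => (hb j x).1) hd hloc H le_rfl _ (measurableSet_strictSet hH p st ac c')
  rw [Finset.sum_const, Finset.card_range, nsmul_eq_mul,
    show (H : ℝ) * (H * (hi - lo)) = H ^ 2 * (hi - lo) by ring] at main
  refine le_trans (measure_mono ?_) main
  intro x hx h h1 h2 a ha
  refine strict_of_weak p st ac hi r hp lo hlo hhi H (extR hH c x) _ ?_ h h1 h2 (hx h h1 h2) a ha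
  intro s a h h1 h2
  unfold extR
  rw [hc, shiftT_apply key δ H hloc H le_rfl, Finset.sum_eq_single (h - 1)]
  · have e : h - 1 + 1 = h := by omega
    simp only [hkey, hδ, e, Prod.mk.injEq, and_true, eq_comm (a := s), eq_comm (a := a)]
    change _ = _ + _ + (if _ then dl p st ac hi r (extR hH c x) (H - h) h else 0)
    ring
  · intro m hm hne
    rw [if_neg]
    intro heq
    simp only [hkey, Prod.mk.injEq, Fin.mk.injEq] at heq
    have := heq.2.2
    have hm := Finset.mem_range.mp hm
    rw [Nat.mod_eq_of_lt (by omega), Nat.mod_eq_of_lt (by omega)] at this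
    omega
  · intro hm
    exact absurd (Finset.mem_range.mpr (by omega)) hm

end Final

lemma traj_event_le {S A : Type} [Fintype S] [Fintype A] [Nonempty A] {H : ℕ} (hH : 0 < H)
    (p : S → A → S → ℝ) (st : ℕ → S) (ac : ℕ → A) (hp : IsKernel p) (η : ℝ) (hη : 0 < η) (lo : ℝ) (r c c' : S → A → ℕ → ℝ)
    (hlo : ∀ s a h, lo ≤ r s a h) (hhi : ∀ s a h, r s a h ≤ lo + 1)
    (hc : ∀ s a h, c' s a h = c s a h + r s a h)
    {Ω : Type} [MeasurableSpace Ω] (P : Measure Ω) [IsProbabilityMeasure P]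
    (R0 : Ω → S → A → ℕ → ℝ)
    (hR0dist : ∀ s a h, 1 ≤ h → h ≤ H →
      Measure.map (fun ω => R0 ω s a h) P = expMeasure η)
    (hR0indep : iIndepFun
      (fun (x : S × A × Fin H) ω => R0 ω x.1 x.2.1 (x.2.2.val + 1)) P)
    (π π' : Ω → S → ℕ → A)
    (ho : ∀ ω, IsOptimal p (fun s a h => R0 ω s a h + c s a h) H (π ω))
    (ho' : ∀ ω, IsOptimal p (fun s a h => R0 ω s a h + c' s a h) H (π' ω)) :
    (P {ω | ∀ h, 1 ≤ h → h ≤ H → π ω (st h) h = ac h}).toReal ≤ Real.exp (η * H ^ 2) *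
      (P {ω | ∀ h, 1 ≤ h → h ≤ H → π' ω (st h) h = ac h}).toReal := by
  have : IsProbabilityMeasure (expMeasure η) := isProbabilityMeasure_expMeasure hη
  set X : Ω → (S × A × Fin H → ℝ) := fun ω x => R0 ω x.1 x.2.1 (x.2.2.val + 1) with hX
  have hm1 : ∀ i : S × A × Fin H,
      Measure.map (fun ω => R0 ω i.1 i.2.1 (i.2.2.val + 1)) P = expMeasure η :=
    fun i => hR0dist _ _ _ (by omega) (by omega)
  have hae : ∀ i : S × A × Fin H, AEMeasurable (fun ω => R0 ω i.1 i.2.1 (i.2.2.val + 1)) P := by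
    intro i
    apply AEMeasurable.of_map_ne_zero
    rw [hm1]
    exact IsProbabilityMeasure.ne_zero _
  have hXae : AEMeasurable X P := aemeasurable_pi_iff.mpr hae
  have hmap : P.map X = Measure.pi (fun _ : S × A × Fin H => expMeasure η) := by
    have := (iIndepFun_iff_map_fun_eq_pi_map hae).mp hR0indep
    simp_rw [hm1] at this
    exact this
  have hext : ∀ (c : S → A → ℕ → ℝ) ω h, 1 ≤ h → h ≤ H → ∀ s a,
      Qf p (fun s a h => R0 ω s a h + c s a h) (H - h) h s a =
      Qf p (extR hH c (X ω)) (H - h) h s a := by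
    intro c ω h h1 h2 s a
    apply Qf_congr
    intro s a j hj1 hj2
    simp only [extR, hX]
    rw [Nat.mod_eq_of_lt (by omega), show j - 1 + 1 = j by omega]
  have e1 : P {ω | ∀ h, 1 ≤ h → h ≤ H → π ω (st h) h = ac h} ≤
      Measure.pi (fun _ : S × A × Fin H => expMeasure η) (weakSet hH p st ac c) := by
    rw [← hmap]
    refine le_trans (measure_mono ?_) (Measure.le_map_apply hXae _)
    intro ω hω h h1 h2 a
    have := (ho ω).ge h h1 h2 (st h) a
    rwa [hω h h1 h2, hext c ω h h1 h2, hext c ω h h1 h2] at this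
  have e2 : Measure.pi (fun _ : S × A × Fin H => expMeasure η) (strictSet hH p st ac c') ≤
      P {ω | ∀ h, 1 ≤ h → h ≤ H → π' ω (st h) h = ac h} := by
    rw [← hmap, Measure.map_apply_of_aemeasurable hXae (measurableSet_strictSet hH p st ac c')]
    refine measure_mono ?_
    intro ω hω h h1 h2
    by_contra hne
    have h3 := hω h h1 h2 _ hne
    have h4 := (ho' ω).ge h h1 h2 (st h) (ac h)
    rw [hext c' ω h h1 h2, hext c' ω h h1 h2] at h4
    linarith
  have key : ∀ ε : ℝ, 0 < ε →
      (P {ω | ∀ h, 1 ≤ h → h ≤ H → π ω (st h) h = ac h}).toReal ≤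
      Real.exp (η * (H ^ 2 * (1 + ε))) *
      (P {ω | ∀ h, 1 ≤ h → h ≤ H → π' ω (st h) h = ac h}).toReal := by
    intro ε hε
    have h := weak_le_strict hH p st ac hp η hη lo (lo + 1 + ε) r c c' hlo
      (fun s a h => by linarith [hhi s a h]) (by linarith) hc
    rw [show lo + 1 + ε - lo = 1 + ε by ring] at h
    have h := (e1.trans h).trans (mul_le_mul_right e2 _)
    have h := ENNReal.toReal_mono (ENNReal.mul_ne_top ENNReal.ofReal_ne_top (measure_ne_top _ _)) h
    rwa [ENNReal.toReal_mul, ENNReal.toReal_ofReal (Real.exp_pos _).le] at h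
  have hcont : Filter.Tendsto (fun ε : ℝ => Real.exp (η * (H ^ 2 * (1 + ε))) *
      (P {ω | ∀ h, 1 ≤ h → h ≤ H → π' ω (st h) h = ac h}).toReal) (nhdsWithin 0 (Set.Ioi 0))
      (nhds (Real.exp (η * (H ^ 2 * (1 + 0))) *
      (P {ω | ∀ h, 1 ≤ h → h ≤ H → π' ω (st h) h = ac h}).toReal)) := by
    apply Filter.Tendsto.mono_left _ nhdsWithin_le_nhds
    apply Continuous.tendsto (by fun_prop)
  rw [add_zero, mul_one] at hcont
  refine ge_of_tendsto hcont ?_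
  filter_upwards [self_mem_nhdsWithin] with ε hε
  exact key ε hε

/-- Under the FPL algorithm with parameter `η > 0`, for every episode `t`
and every trajectory `(s_1, a_1, …, s_H, a_H)` started at the initial state, the probability
of experiencing that trajectory under `π_t` and under `π_{t+1}` satisfies
`Pr_{π_t}[traj] / Pr_{π_{t+1}}[traj] ∈ [e^{−ηH²}, e^{ηH²}]`,
stated here in the equivalent multiplicative (division-free) form. -/
theorem fpl_trajectory_probability_stability
    {S A : Type} [Fintype S] [Fintype A] [Nonempty S] [Nonempty A]
    {Ω : Type} [MeasurableSpace Ω] (P : Measure Ω) [IsProbabilityMeasure P]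
    (H T : ℕ) (hH : 0 < H) (hT : 0 < T) (s₁ : S)
    (p : S → A → S → ℝ) (hp : IsKernel p)
    (η : ℝ) (hη : 0 < η)
    (r : ℕ → S → A → ℕ → ℝ) (hr : ∀ t s a h, 0 ≤ r t s a h ∧ r t s a h ≤ 1)
    (R0 : Ω → S → A → ℕ → ℝ)
    (hR0dist : ∀ s a h, 1 ≤ h → h ≤ H →
      Measure.map (fun ω => R0 ω s a h) P = expMeasure η)
    (hR0indep : iIndepFun
      (fun (x : S × A × Fin H) ω => R0 ω x.1 x.2.1 (x.2.2.val + 1)) P)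
    (π : ℕ → Ω → S → ℕ → A)
    (hπopt : ∀ t ω, IsOptimal p
      (fun s a h => R0 ω s a h + ∑ τ ∈ Finset.Icc 1 (t - 1), r τ s a h) H (π t ω))
    (hπmeas : ∀ t s h a, MeasurableSet {ω | π t ω s h = a}) :
    ∀ t, 1 ≤ t → t ≤ T →
      ∀ (st : ℕ → S) (ac : ℕ → A), st 1 = s₁ →
        trajProb P p (π t) H st ac
            ≤ Real.exp (η * H ^ 2) * trajProb P p (π (t + 1)) H st ac ∧
        trajProb P p (π (t + 1)) H st ac
            ≤ Real.exp (η * H ^ 2) * trajProb P p (π t) H st ac := by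
  intro t ht1 _ st ac _
  have hprod : 0 ≤ ∏ h ∈ Finset.Icc 1 (H - 1), p (st h) (ac h) (st (h + 1)) :=
    Finset.prod_nonneg fun h _ => hp.1 _ _ _
  have hsum : ∀ s a h, ∑ τ ∈ Finset.Icc 1 (t + 1 - 1), r τ s a h =
      ∑ τ ∈ Finset.Icc 1 (t - 1), r τ s a h + r t s a h := by
    intro s a h
    obtain ⟨k, rfl⟩ : ∃ k, t = k + 1 := ⟨t - 1, by omega⟩
    simp only [Nat.add_sub_cancel]
    rw [Finset.sum_Icc_succ_top (by omega)]
  have h1 := traj_event_le hH p st ac hp η hη 0 (r t)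
    (fun s a h => ∑ τ ∈ Finset.Icc 1 (t - 1), r τ s a h)
    (fun s a h => ∑ τ ∈ Finset.Icc 1 (t + 1 - 1), r τ s a h)
    (fun s a h => (hr t s a h).1) (fun s a h => by linarith [(hr t s a h).2]) hsum
    P R0 hR0dist hR0indep (π t) (π (t + 1)) (hπopt t) (hπopt (t + 1))
  have h2 := traj_event_le hH p st ac hp η hη (-1) (fun s a h => - r t s a h)
    (fun s a h => ∑ τ ∈ Finset.Icc 1 (t + 1 - 1), r τ s a h)
    (fun s a h => ∑ τ ∈ Finset.Icc 1 (t - 1), r τ s a h)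
    (fun s a h => by linarith [(hr t s a h).2]) (fun s a h => by linarith [(hr t s a h).1])
    (fun s a h => by rw [hsum]; ring)
    P R0 hR0dist hR0indep (π (t + 1)) (π t) (hπopt (t + 1)) (hπopt t)
  unfold trajProb
  constructor
  · rw [← mul_assoc]; exact mul_le_mul_of_nonneg_right h1 hprod
  · rw [← mul_assoc]; exact mul_le_mul_of_nonneg_right h2 hprod
end
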